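/- Let (R, e, *, d, c) be a nontrivial amorphic C-algebra of degree n with sign ε, all of whose degrees d_r (r ∈ R) are rational numbers. Then for every positive integer N such that N·d_r is a positive integer for every r ∈ R^#, the C-algebra is a fusion of a nontrivial amorphic homogeneous C-algebra with common degree 1/N, dimension (n − 1)·N + 1 and sign ε: there exist such a C-algebra (R', e', *', d', c'), a partition π' of R' with {e'} ∈ π', and a bijection φ : R → π' with φ(e) = {e'} and |φ(r)| = N·d_r, such that c_{r,s}^t = Σ_{u∈φ(r)} Σ_{v∈φ(s)} c'_{u,v}^w for all r, s, t ∈ R and every w ∈ φ(t). In particular, any amorphic C-algebra with rational structure constants is a fusion of infinitely many pairwise non-isomorphic amorphic homogeneous C-algebras. -/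

import Mathlib

open Finset

/-- Data of a `C`-algebra: a unit `e`, an involution `inv` (written `*` in the paper),
degrees `d`, and structure constants `c`. -/
structure CAlgebraData (R : Type*) where
  e : R
  inv : R → R
  d : R → ℝ
  c : R → R → R → ℝ

/-- The axioms of a `C`-algebra. -/
def IsCAlgebra {R : Type*} [Fintype R] [DecidableEq R] (A : CAlgebraData R) : Prop :=
  A.inv A.e = A.e ∧
  (∀ r, A.inv (A.inv r) = r) ∧
  (∀ r, 0 < A.d r) ∧
  (∀ s t, A.c A.e s t = if s = t then 1 else 0) ∧
  (∀ r t, A.c r A.e t = if r = t then 1 else 0) ∧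
  (∀ r s t u, ∑ v, A.c r s v * A.c v t u = ∑ v, A.c r v u * A.c s t v) ∧
  (∀ r s t, A.c r s t = A.c (A.inv s) (A.inv r) (A.inv t)) ∧
  (∀ r s, A.c r s A.e = if s = A.inv r then A.d r else 0) ∧
  A.d A.e = 1 ∧
  (∀ r, A.d (A.inv r) = A.d r) ∧
  (∀ r s, ∑ t, A.d t * A.c r s t = A.d r * A.d s)

/-- `π` is a partition of the (finite) type `R` into nonempty classes. -/
def IsPartition {R : Type*} [Fintype R] (π : Finset (Finset R)) : Prop :=
  (∀ S ∈ π, S.Nonempty) ∧ ∀ r : R, ∃! S, S ∈ π ∧ r ∈ S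

/-- A `C`-algebra is amorphic if every partition of `R` containing `{e}` as a class
gives rise to a fusion `C`-algebra. -/
def IsAmorphic {R : Type*} [Fintype R] [DecidableEq R] (A : CAlgebraData R) : Prop :=
  ∀ π : Finset (Finset R), IsPartition π → ({A.e} : Finset R) ∈ π →
    (∀ S ∈ π, S.image A.inv ∈ π) ∧
    ∀ S ∈ π, ∀ T ∈ π, ∀ U ∈ π, ∀ u ∈ U, ∀ v ∈ U,
      ∑ r ∈ S, ∑ s ∈ T, A.c r s u = ∑ r ∈ S, ∑ s ∈ T, A.c r s v

/-- The degree `n` of a `C`-algebra. -/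
noncomputable def CAlgebraData.degree {R : Type*} [Fintype R] (A : CAlgebraData R) : ℝ :=
  ∑ r, A.d r

/-- `ε ∈ {-1, 1}` is the sign of a (nontrivial amorphic) `C`-algebra. -/
def IsSign {R : Type*} [Fintype R] (A : CAlgebraData R) (ε : ℝ) : Prop :=
  (ε = -1 ∨ ε = 1) ∧ 0 < Real.sqrt A.degree + ε ∧
    ∀ r s t, r ≠ A.e → s ≠ A.e → t ≠ A.e → r ≠ s → s ≠ t → r ≠ t →
      A.c r s t = A.d r * A.d s / (Real.sqrt A.degree + ε) ^ 2

/-! ### Structure constants of an amorphic algebra with a sign -/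

section Coefficients

variable {R : Type*} [Fintype R] [DecidableEq R] {A : CAlgebraData R}

/-- The structure constants between nonunit elements, in terms of weights `g`, the square root `s`
of the degree and the sign `ε`. -/
noncomputable def amorphicCoeff {X : Type*} [DecidableEq X] (g : X → ℝ) (s ε : ℝ)
    (a b c : X) : ℝ :=
  g a * g b + ε * ((if a = b then g a else 0) + (if a = c then g b else 0)
    + (if b = c then g a else 0)) - ε * s * (if a = b then if b = c then 1 else 0 else 0)

theorem exists_ne_ne_ne_of_four_le_card (h : 4 ≤ Fintype.card R) (a b c : R) :
    ∃ x, x ≠ a ∧ x ≠ b ∧ x ≠ c := by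
  have hlt : ({a, b, c} : Finset R).card < (univ : Finset R).card := by
    have := Finset.card_le_three (a := a) (b := b) (c := c)
    rw [Finset.card_univ]; omega
  obtain ⟨x, -, hx⟩ := Finset.exists_mem_notMem_of_card_lt_card hlt
  simp only [mem_insert, mem_singleton, not_or] at hx
  exact ⟨x, hx⟩

/-- The partition `{e}, {r}, R \ {e, r}`. -/
theorem isPartition_unit_singleton_rest (hnt : 4 ≤ Fintype.card R) (e r : R) (hr : r ≠ e) :
    IsPartition ({{e}, {r}, ({e, r} : Finset R)ᶜ} : Finset (Finset R)) := by
  refine ⟨?_, fun x => ?_⟩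
  · obtain ⟨x, hxe, hxr, -⟩ := exists_ne_ne_ne_of_four_le_card hnt e r r
    intro S hS
    simp only [mem_insert, mem_singleton] at hS
    rcases hS with rfl | rfl | rfl
    · simp
    · simp
    · exact ⟨x, by simp [hxe, hxr]⟩
  · by_cases hxe : x = e
    · subst hxe
      exact ⟨{x}, by simp, by rintro S ⟨hS, hx⟩; aesop⟩
    · by_cases hxr : x = r
      · subst hxr
        exact ⟨{x}, by simp, by rintro S ⟨hS, hx⟩; aesop⟩
      · exact ⟨({e, r} : Finset R)ᶜ, by simp [hxe, hxr], by rintro S ⟨hS, hx⟩; aesop⟩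

theorem IsAmorphic.inv_eq_self (hA : IsCAlgebra A) (hnt : 4 ≤ Fintype.card R)
    (ham : IsAmorphic A) (r : R) : A.inv r = r := by
  obtain ⟨hie, hii, -⟩ := hA
  by_cases hr : r = A.e
  · rw [hr, hie]
  have h := (ham _ (isPartition_unit_singleton_rest hnt A.e r hr) (by simp)).1 {r} (by simp)
  simp only [image_singleton, mem_insert, mem_singleton, singleton_inj] at h
  rcases h with h | h | h
  · exact absurd (by rw [← hii r, h, hie]) hr
  · exact h
  · obtain ⟨x, hxe, hxr, hxi⟩ := exists_ne_ne_ne_of_four_le_card hnt A.e r (A.inv r)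
    have : x ∈ ({A.inv r} : Finset R) := by rw [h]; simp [hxe, hxr]
    exact absurd (mem_singleton.mp this) hxi

theorem IsAmorphic.c_self_eq (hnt : 4 ≤ Fintype.card R) (ham : IsAmorphic A) {r u v : R}
    (hr : r ≠ A.e) (hu : u ≠ A.e) (hur : u ≠ r) (hv : v ≠ A.e) (hvr : v ≠ r) :
    A.c r r u = A.c r r v := by
  have h := (ham _ (isPartition_unit_singleton_rest hnt A.e r hr) (by simp)).2 {r} (by simp)
    {r} (by simp) ({A.e, r} : Finset R)ᶜ (by simp) u (by simp [hu, hur]) v (by simp [hv, hvr])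
  simpa using h

theorem IsCAlgebra.degree_pos (hA : IsCAlgebra A) : 0 < A.degree :=
  Finset.sum_pos (fun r _ => hA.2.2.1 r) ⟨A.e, mem_univ _⟩

theorem IsCAlgebra.d_mul_c (hA : IsCAlgebra A) (hinv : ∀ r, A.inv r = r) (r s t : R) :
    A.d t * A.c r s t = A.d r * A.c s t r := by
  obtain ⟨-, -, -, -, -, hassoc, -, he, -⟩ := hA
  have h := hassoc r s t A.e
  simp only [he, hinv, mul_ite, mul_zero, ite_mul, zero_mul, sum_ite_eq, sum_ite_eq', mem_univ, if_true] at h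
  linarith

theorem IsCAlgebra.sum_c (hA : IsCAlgebra A) (hinv : ∀ r, A.inv r = r) (r s : R) :
    ∑ t, A.c s t r = A.d s := by
  have h := hA.2.2.2.2.2.2.2.2.2.2 r s
  rw [Finset.sum_congr rfl fun t _ => hA.d_mul_c hinv r s t, ← Finset.mul_sum] at h
  exact mul_left_cancel₀ (hA.2.2.1 r).ne' h

theorem IsCAlgebra.c_comm (hA : IsCAlgebra A) (hinv : ∀ r, A.inv r = r) (r s t : R) :
    A.c r s t = A.c s r t := by
  have h := hA.2.2.2.2.2.2.1 r s t
  simpa only [hinv] using h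

theorem IsSign.sq_eq_one {R : Type*} [Fintype R] {A : CAlgebraData R} {ε : ℝ} (hε : IsSign A ε) : ε ^ 2 = 1 := by
  rcases hε.1 with h | h <;> rw [h] <;> norm_num

theorem IsSign.sum_weights (hA : IsCAlgebra A) {ε : ℝ} (hε : IsSign A ε) :
    ∑ t ∈ univ.erase A.e, A.d t / (√A.degree + ε) = √A.degree - ε := by
  have hd := Finset.add_sum_erase univ A.d (mem_univ A.e)
  have hsq := Real.sq_sqrt hA.degree_pos.le
  have h1 := hε.sq_eq_one
  rw [hA.2.2.2.2.2.2.2.2.1] at hd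
  change _ = A.degree at hd
  rw [← Finset.sum_div, div_eq_iff hε.2.1.ne']
  linear_combination hd - hsq + h1

theorem IsAmorphic.c_add_c (hA : IsCAlgebra A) (hnt : 4 ≤ Fintype.card R) (ham : IsAmorphic A)
    {ε : ℝ} (hε : IsSign A ε) {r s : R} (hr : r ≠ A.e) (hs : s ≠ A.e) (hrs : r ≠ s) :
    A.c r r s + A.c r s s = A.d r / (√A.degree + ε) *
      (A.d r / (√A.degree + ε) + A.d s / (√A.degree + ε) + 2 * ε) := by
  have hinv := ham.inv_eq_self hA hnt
  have hm := hε.2.1.ne'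
  have hsum := hA.sum_c hinv s r
  have hw := hε.sum_weights hA
  have hr' : r ∈ univ.erase A.e := by simp [hr]
  have hs' : s ∈ (univ.erase A.e).erase r := by simp [hs, hrs.symm]
  rw [← Finset.add_sum_erase _ _ (mem_univ A.e), ← Finset.add_sum_erase _ _ hr',
    ← Finset.add_sum_erase _ _ hs', hA.2.2.2.2.1, if_neg hrs] at hsum
  rw [← Finset.add_sum_erase _ _ hr', ← Finset.add_sum_erase _ _ hs'] at hw
  have hrest : ∑ t ∈ ((univ.erase A.e).erase r).erase s, A.c r t s =
      A.d r / (√A.degree + ε) *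
        ∑ t ∈ ((univ.erase A.e).erase r).erase s, A.d t / (√A.degree + ε) := by
    rw [Finset.mul_sum]
    refine Finset.sum_congr rfl fun t ht => ?_
    simp only [mem_erase, mem_univ, and_true] at ht
    rw [hε.2.2 r t s hr ht.2.2 hs (Ne.symm ht.2.1) ht.1 hrs]
    field_simp
  have hdr : A.d r = A.d r / (√A.degree + ε) * (√A.degree + ε) := by field_simp
  rw [hrest] at hsum
  linear_combination hsum - A.d r / (√A.degree + ε) * hw + hdr

theorem IsAmorphic.c_self_of_ne (hA : IsCAlgebra A) (hnt : 4 ≤ Fintype.card R)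
    (ham : IsAmorphic A) {ε : ℝ} (hε : IsSign A ε) {r s : R} (hr : r ≠ A.e) (hs : s ≠ A.e)
    (hrs : r ≠ s) :
    A.c r r s = A.d r / (√A.degree + ε) * (A.d r / (√A.degree + ε) + ε) := by
  have hinv := ham.inv_eq_self hA hnt
  have hm := hε.2.1.ne'
  obtain ⟨t, hte, htr, hts⟩ := exists_ne_ne_ne_of_four_le_card hnt A.e r s
  -- the excess of `c x x y / d x` over its expected value sums to zero over each pair
  have key : ∀ x y, x ≠ A.e → y ≠ A.e → x ≠ y →
      A.c x x y / A.d x + A.c y y x / A.d y = (A.d x / (√A.degree + ε)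
        + A.d y / (√A.degree + ε) + 2 * ε) / (√A.degree + ε) := by
    intro x y hx hy hxy
    have hdx := (hA.2.2.1 x).ne'
    have hdy := (hA.2.2.1 y).ne'
    have h1 := ham.c_add_c hA hnt hε hx hy hxy
    have h2 : A.c x y y = A.d x * A.c y y x / A.d y := by
      rw [eq_div_iff hdy, ← hA.d_mul_c hinv]; ring
    rw [h2] at h1
    have h3 : A.c x x y / A.d x + A.c y y x / A.d y =
        (A.c x x y + A.d x * A.c y y x / A.d y) / A.d x := by field_simp
    rw [h3, h1]
    field_simp
  have e1 := key r s hr hs hrs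
  have e2 := key r t hr hte htr.symm
  have e3 := key s t hs hte hts.symm
  rw [ham.c_self_eq hnt hr hte htr hs hrs.symm, ham.c_self_eq hnt hte hr htr.symm hs hts.symm]
    at e2
  rw [ham.c_self_eq hnt hs hte hts hr hrs] at e3
  have h : A.c r r s / A.d r = (A.d r / (√A.degree + ε) + ε) / (√A.degree + ε) := by
    linear_combination (e1 + e2 - e3) / 2
  rw [div_eq_iff (hA.2.2.1 r).ne'] at h
  rw [h]; ring

theorem IsAmorphic.c_of_ne (hA : IsCAlgebra A) (hnt : 4 ≤ Fintype.card R)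
    (ham : IsAmorphic A) {ε : ℝ} (hε : IsSign A ε) {r s : R} (hr : r ≠ A.e) (hs : s ≠ A.e)
    (hrs : r ≠ s) :
    A.c r s r = A.d s / (√A.degree + ε) * (A.d r / (√A.degree + ε) + ε) := by
  have hinv := ham.inv_eq_self hA hnt
  have h := hA.d_mul_c hinv r r s
  rw [ham.c_self_of_ne hA hnt hε hr hs hrs] at h
  refine mul_left_cancel₀ (hA.2.2.1 r).ne' ?_
  linear_combination -h

theorem IsAmorphic.c_eq_amorphicCoeff (hA : IsCAlgebra A) (hnt : 4 ≤ Fintype.card R)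
    (ham : IsAmorphic A) {ε : ℝ} (hε : IsSign A ε) {r s t : R} (hr : r ≠ A.e) (hs : s ≠ A.e)
    (ht : t ≠ A.e) :
    A.c r s t = amorphicCoeff (fun x => A.d x / (√A.degree + ε)) (√A.degree) ε r s t := by
  have hinv := ham.inv_eq_self hA hnt
  have hm := hε.2.1.ne'
  unfold amorphicCoeff
  by_cases hrs : r = s
  · subst hrs
    by_cases hrt : r = t
    · subst hrt
      have hsum := hA.sum_c hinv r r
      have hw := hε.sum_weights hA
      have hr' : r ∈ univ.erase A.e := by simp [hr]
      rw [← Finset.add_sum_erase _ _ (mem_univ A.e), ← Finset.add_sum_erase _ _ hr',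
        hA.2.2.2.2.1, if_pos rfl] at hsum
      rw [← Finset.add_sum_erase _ _ hr'] at hw
      have hrest : ∑ t ∈ (univ.erase A.e).erase r, A.c r t r =
          (∑ t ∈ (univ.erase A.e).erase r, A.d t / (√A.degree + ε)) *
            (A.d r / (√A.degree + ε) + ε) := by
        rw [Finset.sum_mul]
        refine Finset.sum_congr rfl fun t ht => ?_
        simp only [mem_erase, mem_univ, and_true] at ht
        exact ham.c_of_ne hA hnt hε hr ht.2 (Ne.symm ht.1)
      have hdr : A.d r = A.d r / (√A.degree + ε) * (√A.degree + ε) := by field_simp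
      have h1 := hε.sq_eq_one
      rw [hrest] at hsum
      simp only [if_true]
      linear_combination hsum - (A.d r / (√A.degree + ε) + ε) * hw + hdr + h1
    · simp only [if_true, if_neg hrt]
      rw [ham.c_self_of_ne hA hnt hε hr ht hrt]; ring
  · by_cases hrt : r = t
    · subst hrt
      simp only [if_true, if_neg hrs, if_neg (Ne.symm hrs)]
      rw [ham.c_of_ne hA hnt hε hr hs hrs]; ring
    · by_cases hst : s = t
      · subst hst
        simp only [if_true, if_neg hrs]
        rw [hA.c_comm hinv, ham.c_of_ne hA hnt hε hs hr (Ne.symm hrs)]; ring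
      · simp only [if_neg hrs, if_neg hrt, if_neg hst]
        rw [hε.2.2 r s t hr hs ht hrs hst hrt]
        field_simp
        ring

end Coefficients

/-! ### The homogeneous amorphic algebra -/

section Homogeneous

variable {X : Type*} [DecidableEq X]

/-- The amorphic algebra on `Option X` all of whose nonunit elements have weight `g`. -/
noncomputable def homogeneousAmorphic (X : Type*) [DecidableEq X] (g s ε : ℝ) :
    CAlgebraData (Option X) where
  e := none
  inv := id
  d := fun u => u.elim 1 fun _ => g * (s + ε)
  c := fun u v w =>
    match u, v, w with
    | none, v, w => if v = w then 1 else 0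
    | some a, none, w => if some a = w then 1 else 0
    | some a, some b, none => if a = b then g * (s + ε) else 0
    | some a, some b, some c => amorphicCoeff (fun _ => g) s ε a b c

theorem amorphicCoeff_comm (g s ε : ℝ) (a b c : X) :
    amorphicCoeff (fun _ => g) s ε a b c = amorphicCoeff (fun _ => g) s ε b a c := by
  unfold amorphicCoeff
  by_cases h : a = b
  · rw [h]
  · simp only [if_neg h, if_neg (Ne.symm h)]; ring

theorem amorphicCoeff_rotate (g s ε : ℝ) (a b c : X) :
    amorphicCoeff (fun _ => g) s ε a b c = amorphicCoeff (fun _ => g) s ε b c a := by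
  unfold amorphicCoeff
  by_cases h : a = b <;> by_cases h' : b = c <;> by_cases h'' : a = c <;>
    simp_all [eq_comm]

theorem homogeneousAmorphic_c_none_left (g s ε : ℝ) (v w : Option X) :
    (homogeneousAmorphic X g s ε).c none v w = if v = w then 1 else 0 :=
  rfl

theorem homogeneousAmorphic_c_none_right (g s ε : ℝ) (u w : Option X) :
    (homogeneousAmorphic X g s ε).c u none w = if u = w then 1 else 0 := by
  cases u <;> rfl

theorem homogeneousAmorphic_c_some_some_none (g s ε : ℝ) (a b : X) :
    (homogeneousAmorphic X g s ε).c (some a) (some b) none = if a = b then g * (s + ε) else 0 :=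
  rfl

theorem homogeneousAmorphic_c_some_some_some (g s ε : ℝ) (a b c : X) :
    (homogeneousAmorphic X g s ε).c (some a) (some b) (some c) =
      amorphicCoeff (fun _ => g) s ε a b c :=
  rfl

theorem homogeneousAmorphic_c_perm (g s ε : ℝ) (σ : Equiv.Perm (Option X)) (hσ : σ none = none)
    (u v w : Option X) : (homogeneousAmorphic X g s ε).c (σ u) (σ v) (σ w) =
      (homogeneousAmorphic X g s ε).c u v w := by
  have hsome : ∀ a, ∃ b, σ (some a) = some b := fun a =>
    Option.ne_none_iff_exists'.mp fun h => by
      have := σ.injective (h.trans hσ.symm)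
      simp at this
  choose τ hτ using hsome
  have hinj : ∀ a b, τ a = τ b ↔ a = b := fun a b => by
    rw [← Option.some_inj, ← hτ, ← hτ, σ.injective.eq_iff, Option.some_inj]
  cases u with
  | none => simp only [hσ, homogeneousAmorphic_c_none_left, σ.injective.eq_iff]
  | some a =>
    cases v with
    | none => simp only [hσ, homogeneousAmorphic_c_none_right, σ.injective.eq_iff]
    | some b =>
      cases w with
      | none => simp only [hσ, hτ, homogeneousAmorphic_c_some_some_none, hinj]
      | some c => simp only [hτ, homogeneousAmorphic_c_some_some_some, amorphicCoeff, hinj]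

variable [Fintype X]

theorem sum_amorphicCoeff_mul (g s ε : ℝ) (a b : X) (f : X → ℝ) :
    ∑ x, amorphicCoeff (fun _ => g) s ε a b x * f x =
      (g ^ 2 + if a = b then ε * g else 0) * ∑ x, f x + ε * g * (f a + f b)
        - if a = b then ε * s * f a else 0 := by
  have h : ∀ x, amorphicCoeff (fun _ => g) s ε a b x * f x =
      (g ^ 2 + if a = b then ε * g else 0) * f x + ε * g * ((if a = x then f x else 0)
        + if b = x then f x else 0) - if a = b then ε * s * (if a = x then f x else 0) else 0 := by
    intro x
    unfold amorphicCoeff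
    rcases eq_or_ne a b with rfl | hab
    · rcases eq_or_ne a x with rfl | hax
      · simp only [if_true]; ring
      · simp only [if_true, if_neg hax]; ring
    · rcases eq_or_ne a x with rfl | hax
      · simp only [if_true, if_neg hab, if_neg hab.symm]; ring
      · rcases eq_or_ne b x with rfl | hbx
        · simp only [if_true, if_neg hab]; ring
        · simp only [if_neg hab, if_neg hax, if_neg hbx]; ring
  simp only [h, Finset.sum_sub_distrib, Finset.sum_add_distrib, ← Finset.mul_sum]
  by_cases hab : a = b <;> simp [hab]

theorem sum_amorphicCoeff {g s ε : ℝ} (hε : ε ^ 2 = 1) (hg : Fintype.card X * g = s - ε)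
    (a b : X) :
    ∑ x, amorphicCoeff (fun _ => g) s ε a b x = g * (s + ε) - if a = b then 1 else 0 := by
  have h := sum_amorphicCoeff_mul g s ε a b fun _ => 1
  simp only [mul_one, sum_const, card_univ, nsmul_eq_mul] at h
  rw [h]
  by_cases hab : a = b
  · simp only [hab, if_true]
    linear_combination (g + ε) * hg - hε
  · simp only [hab, if_false]
    linear_combination g * hg

theorem amorphicCoeff_assoc {g s ε : ℝ} (hε : ε ^ 2 = 1) (hg : Fintype.card X * g = s - ε)
    (a b c u : X) :
    (if a = b then g * (s + ε) else 0) * (if c = u then 1 else 0)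
      + ∑ x, amorphicCoeff (fun _ => g) s ε a b x * amorphicCoeff (fun _ => g) s ε x c u =
    (if a = u then 1 else 0) * (if b = c then g * (s + ε) else 0)
      + ∑ x, amorphicCoeff (fun _ => g) s ε a x u * amorphicCoeff (fun _ => g) s ε b c x := by
  have h2 : ∀ x, amorphicCoeff (fun _ => g) s ε a x u * amorphicCoeff (fun _ => g) s ε b c x =
      amorphicCoeff (fun _ => g) s ε b c x * amorphicCoeff (fun _ => g) s ε x a u := fun x => by
    rw [mul_comm, amorphicCoeff_comm g s ε a x u]
  have h3 : ∀ y z, ∑ x, amorphicCoeff (fun _ => g) s ε x y z =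
      g * (s + ε) - if y = z then 1 else 0 := fun y z => by
    rw [← sum_amorphicCoeff hε hg]
    exact Finset.sum_congr rfl fun x _ => amorphicCoeff_rotate g s ε x y z
  simp only [h2, sum_amorphicCoeff_mul, h3]
  clear h2 h3 hg
  rw [amorphicCoeff_comm g s ε b a u, amorphicCoeff_comm g s ε c a u]
  unfold amorphicCoeff
  split_ifs <;> grind

theorem isCAlgebra_homogeneousAmorphic {g s ε : ℝ} (hε : ε ^ 2 = 1)
    (hg : Fintype.card X * g = s - ε) (hd : 0 < g * (s + ε)) :
    IsCAlgebra (homogeneousAmorphic X g s ε) := by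
  refine ⟨rfl, fun _ => rfl, ?_, fun _ _ => rfl, homogeneousAmorphic_c_none_right g s ε,
    ?_, ?_, ?_, rfl, fun _ => rfl, ?_⟩
  · rintro (_ | a)
    · exact one_pos
    · exact hd
  · rintro (_ | a)
    · simp [homogeneousAmorphic_c_none_left]
    rintro (_ | b)
    · simp [homogeneousAmorphic_c_none_left, homogeneousAmorphic_c_none_right]
    rintro (_ | c)
    · simp [homogeneousAmorphic_c_none_right]
    rintro (_ | u)
    · simp only [Fintype.sum_option, homogeneousAmorphic_c_none_left,
        homogeneousAmorphic_c_none_right, homogeneousAmorphic_c_some_some_none,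
        homogeneousAmorphic_c_some_some_some, reduceCtorEq, if_false, mul_zero, zero_mul, zero_add,
        mul_ite, ite_mul, ite_self, sum_ite_eq, sum_ite_eq', mem_univ, if_true]
      rw [amorphicCoeff_rotate, mul_comm]
    · simpa [Fintype.sum_option, homogeneousAmorphic_c_none_left,
        homogeneousAmorphic_c_none_right, homogeneousAmorphic_c_some_some_none,
        homogeneousAmorphic_c_some_some_some] using amorphicCoeff_assoc hε hg a b c u
  · rintro (_ | a) (_ | b) w
    · rfl
    · rfl
    · rfl
    · cases w with
      | none => simp [homogeneousAmorphic, eq_comm]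
      | some c => exact amorphicCoeff_comm _ _ _ _ _ _
  · rintro (_ | a) (_ | b) <;> simp [homogeneousAmorphic, eq_comm]
  · rintro (_ | a) (_ | b)
    · simp [homogeneousAmorphic]
    · simp [homogeneousAmorphic]
    · simp [homogeneousAmorphic]
    · have h := sum_amorphicCoeff hε hg a b
      simp only [Fintype.sum_option, homogeneousAmorphic_c_some_some_none,
        homogeneousAmorphic_c_some_some_some]
      simp only [homogeneousAmorphic, Option.elim, ← Finset.mul_sum, h]
      split_ifs <;> ring

theorem degree_homogeneousAmorphic {g s ε : ℝ} (hε : ε ^ 2 = 1)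
    (hg : Fintype.card X * g = s - ε) : (homogeneousAmorphic X g s ε).degree = s ^ 2 := by
  simp only [CAlgebraData.degree, Fintype.sum_option, homogeneousAmorphic, Option.elim, sum_const,
    card_univ, nsmul_eq_mul]
  linear_combination (s + ε) * hg - hε

theorem isAmorphic_homogeneousAmorphic (g s ε : ℝ) :
    IsAmorphic (homogeneousAmorphic X g s ε) := by
  intro π hπ he
  refine ⟨fun S hS => by simpa [homogeneousAmorphic] using hS, ?_⟩
  intro S hS T hT U hU u hu v hv
  have hmem : ∀ W ∈ π, u ∈ W ↔ v ∈ W := by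
    intro W hW
    constructor <;> intro h
    · rwa [(hπ.2 u).unique ⟨hW, h⟩ ⟨hU, hu⟩]
    · rwa [(hπ.2 v).unique ⟨hW, h⟩ ⟨hU, hv⟩]
  have hnone : u = none ↔ v = none := by
    simpa [homogeneousAmorphic] using hmem _ he
  have hfix : Equiv.swap u v none = none := by
    by_cases h : u = none
    · rw [h, hnone.mp h]; simp
    · exact Equiv.swap_apply_of_ne_of_ne (Ne.symm h) (Ne.symm fun h' => h (hnone.mpr h'))
  have hpres : ∀ W ∈ π, ∀ x, x ∈ W ↔ Equiv.swap u v x ∈ W := by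
    intro W hW x
    rcases eq_or_ne x u with rfl | hxu
    · rw [Equiv.swap_apply_left, hmem W hW]
    · rcases eq_or_ne x v with rfl | hxv
      · rw [Equiv.swap_apply_right, hmem W hW]
      · rw [Equiv.swap_apply_of_ne_of_ne hxu hxv]
  refine Finset.sum_equiv (Equiv.swap u v) (hpres S hS) fun x _ => ?_
  refine Finset.sum_equiv (Equiv.swap u v) (hpres T hT) fun y _ => ?_
  rw [← homogeneousAmorphic_c_perm g s ε (Equiv.swap u v) hfix, Equiv.swap_apply_left]

theorem isSign_homogeneousAmorphic {g s ε : ℝ} (hε : ε = -1 ∨ ε = 1) (hs : 0 ≤ s)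
    (hsε : 0 < s + ε) (hg : Fintype.card X * g = s - ε) :
    IsSign (homogeneousAmorphic X g s ε) ε := by
  have hsq : ε ^ 2 = 1 := by rcases hε with h | h <;> rw [h] <;> norm_num
  have hsqrt : √(homogeneousAmorphic X g s ε).degree = s := by
    rw [degree_homogeneousAmorphic hsq hg, Real.sqrt_sq hs]
  refine ⟨hε, by rwa [hsqrt], ?_⟩
  intro u v w hu hv hw hab hbc hac
  obtain ⟨a, rfl⟩ := Option.ne_none_iff_exists'.mp hu
  obtain ⟨b, rfl⟩ := Option.ne_none_iff_exists'.mp hv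
  obtain ⟨c, rfl⟩ := Option.ne_none_iff_exists'.mp hw
  rw [hsqrt, homogeneousAmorphic_c_some_some_some]
  simp only [ne_eq, Option.some_inj] at hab hbc hac
  simp only [amorphicCoeff, if_neg hab, if_neg hbc, if_neg hac, homogeneousAmorphic, Option.elim]
  field_simp
  ring

end Homogeneous

/-! ### Fusions of the homogeneous amorphic algebra -/

theorem exists_fin_map_card_fiber {R : Type*} [Fintype R] [DecidableEq R] (k : R → ℕ) :
    ∃ (M : ℕ) (f : Fin M → R), ∀ r, (univ.filter fun i => f i = r).card = k r := by
  let e := Fintype.equivFin (Σ r, Fin (k r))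
  refine ⟨_, fun i => (e.symm i).1, fun r => ?_⟩
  have hinj : Function.Injective fun j : Fin (k r) => e ⟨r, j⟩ := fun i j hij => by
    simpa using hij
  have h : (univ.filter fun i => (e.symm i).1 = r) = univ.image fun j : Fin (k r) => e ⟨r, j⟩ := by
    ext i
    simp only [mem_filter, mem_univ, true_and, mem_image]
    constructor
    · rintro rfl
      exact ⟨(e.symm i).2, by simp⟩
    · rintro ⟨j, rfl⟩
      simp
  rw [h, card_image_of_injective _ hinj, card_univ, Fintype.card_fin]

theorem sum_sum_amorphicCoeff {X R : Type*} [DecidableEq X] [DecidableEq R] [Fintype X]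
    (f : X → R) (g s ε : ℝ) (p q : R) (x : X) :
    ∑ a with f a = p, ∑ b with f b = q, amorphicCoeff (fun _ => g) s ε a b x =
      amorphicCoeff (fun r => (univ.filter fun a => f a = r).card * g) s ε p q (f x) := by
  have hab : ∀ a, ∑ b with f b = q, (if a = b then g else 0) = if f a = q then g else 0 := by
    intro a; simp [Finset.sum_ite_eq]
  have hbx : ∀ y : ℝ, ∀ q, ∑ b with f b = q, (if b = x then y else 0) =
      if q = f x then y else 0 := by
    intro y q; simp [eq_comm]
  have habx : ∀ a, ∑ b with f b = q, (if a = b then if b = x then (1 : ℝ) else 0 else 0) =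
      if f a = q then if a = x then 1 else 0 else 0 := by
    intro a; simp [Finset.sum_ite_eq]
  have hfilter : ∀ h : X → ℝ, ∑ a with f a = p, (if f a = q then h a else 0) =
      if p = q then ∑ a with f a = p, h a else 0 := by
    intro h
    rw [Finset.sum_congr rfl (g := fun a => if p = q then h a else 0)
      fun a ha => by rw [(mem_filter.mp ha).2]]
    split_ifs <;> simp
  simp only [amorphicCoeff, Finset.sum_sub_distrib, Finset.sum_add_distrib, ← Finset.mul_sum,
    hab, hbx, habx, hfilter, sum_const, nsmul_eq_mul]
  split_ifs <;> simp_all <;> ring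

/-- a nontrivial amorphic `C`-algebra with sign `ε` all of whose degrees are
rational is, for every positive integer `N` with `N·d_r ∈ ℕ` for all `r ∈ R^#`, a fusion
of a nontrivial amorphic homogeneous `C`-algebra of common degree `1/N`, dimension
`(n-1)·N + 1` and sign `ε`. -/
theorem stmt_15 {R : Type*} [Fintype R] [DecidableEq R] (A : CAlgebraData R)
    (hA : IsCAlgebra A) (hnt : 4 ≤ Fintype.card R) (ham : IsAmorphic A)
    (ε : ℝ) (hε : IsSign A ε)
    (hrat : ∀ r, ∃ q : ℚ, A.d r = q) :
    ∀ N : ℕ, 0 < N → (∀ r, r ≠ A.e → ∃ k : ℕ, 0 < k ∧ (N : ℝ) * A.d r = k) →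
    ∃ (R' : Type) (fR' : Fintype R') (dR' : DecidableEq R') (A' : CAlgebraData R')
      (π' : Finset (Finset R')) (φ : R → Finset R'),
      @IsCAlgebra R' fR' dR' A' ∧
      4 ≤ @Fintype.card R' fR' ∧
      @IsAmorphic R' fR' dR' A' ∧
      (@Fintype.card R' fR' : ℝ) = (A.degree - 1) * N + 1 ∧
      (∀ u, u ≠ A'.e → A'.d u = 1 / N) ∧
      @IsSign R' fR' A' ε ∧
      @IsPartition R' fR' π' ∧ ({A'.e} : Finset R') ∈ π' ∧
      (∀ r, φ r ∈ π') ∧ Function.Injective φ ∧ (∀ S ∈ π', ∃ r, φ r = S) ∧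
      φ A.e = {A'.e} ∧
      (∀ r, r ≠ A.e → ((φ r).card : ℝ) = N * A.d r) ∧
      (∀ r s t, ∀ w ∈ φ t, A.c r s t = ∑ u ∈ φ r, ∑ v ∈ φ s, A'.c u v w) := by
  intro N hN hk
  have hN' : (0 : ℝ) < N := Nat.cast_pos.mpr hN
  set s := √A.degree with hs
  have hsε : 0 < s + ε := hε.2.1
  have hsq := hε.sq_eq_one
  have hk' : ∀ r, ∃ k : ℕ, (r = A.e → k = 0) ∧ (r ≠ A.e → 0 < k ∧ (N : ℝ) * A.d r = k) := by
    intro r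
    by_cases hr : r = A.e
    · exact ⟨0, fun _ => rfl, fun h => absurd hr h⟩
    · obtain ⟨k, hk⟩ := hk r hr
      exact ⟨k, fun h => absurd h hr, fun _ => hk⟩
  choose k hke hkd using hk'
  obtain ⟨M, f, hf⟩ := exists_fin_map_card_fiber k
  have hfe : ∀ i, f i ≠ A.e := by
    intro i hi
    have h := hf A.e
    rw [hke A.e rfl, card_eq_zero] at h
    exact notMem_empty i (h ▸ by simp [hi])
  have hcard : ∀ r, r ≠ A.e → ((univ.filter fun i => f i = r).card : ℝ) = N * A.d r :=
    fun r hr => by rw [hf, (hkd r hr).2]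
  have hM : (M : ℝ) = (A.degree - 1) * N := by
    have h1 : (univ : Finset (Fin M)).card = ∑ r ∈ univ.erase A.e,
        (univ.filter fun i => f i = r).card :=
      Finset.card_eq_sum_card_fiberwise fun i _ => by simp [hfe]
    rw [card_univ, Fintype.card_fin] at h1
    have hd := Finset.add_sum_erase univ A.d (mem_univ A.e)
    rw [hA.2.2.2.2.2.2.2.2.1] at hd
    change _ = A.degree at hd
    rw [h1, Nat.cast_sum, Finset.sum_congr rfl fun r hr => hcard r (ne_of_mem_erase hr),
      ← Finset.mul_sum]
    linear_combination N * hd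
  set g : ℝ := 1 / (N * (s + ε)) with hgdef
  have hgd : g * (s + ε) = 1 / N := by rw [hgdef]; field_simp
  have hg : (Fintype.card (Fin M) : ℝ) * g = s - ε := by
    have hss : s ^ 2 = A.degree := Real.sq_sqrt hA.degree_pos.le
    rw [Fintype.card_fin, hM, hgdef, mul_one_div, div_eq_iff (by positivity), ← hss]
    linear_combination N * hsq
  let F : Option (Fin M) → R := fun u => u.elim A.e f
  have hF : Function.Surjective F := by
    intro r
    by_cases hr : r = A.e
    · exact ⟨none, hr.symm⟩
    · have h : 0 < (univ.filter fun i => f i = r).card := by rw [hf]; exact (hkd r hr).1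
      obtain ⟨i, hi⟩ := card_pos.mp h
      exact ⟨some i, (mem_filter.mp hi).2⟩
  let φ : R → Finset (Option (Fin M)) := fun r => univ.filter fun u => F u = r
  have hmem : ∀ r u, u ∈ φ r ↔ F u = r := fun r u => by simp [φ]
  have hφe : φ A.e = {none} := by
    ext u
    cases u with
    | none => simp [hmem, F]
    | some i => simp [hmem, F, hfe]
  have hφ : ∀ r, r ≠ A.e → φ r = (univ.filter fun i => f i = r).map Function.Embedding.some := by
    intro r hr
    ext u
    cases u with
    | none => simp [hmem, F, hr.symm]
    | some i => simp [hmem, F]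
  refine ⟨Option (Fin M), inferInstance, inferInstance, homogeneousAmorphic (Fin M) g s ε,
    univ.image φ, φ, isCAlgebra_homogeneousAmorphic hsq hg (by rw [hgd]; positivity),
    hnt.trans (Fintype.card_le_of_surjective F hF), isAmorphic_homogeneousAmorphic g s ε,
    by simp [hM], ?_, isSign_homogeneousAmorphic hε.1 (Real.sqrt_nonneg _) hsε hg, ⟨?_, ?_⟩,
    mem_image.mpr ⟨A.e, mem_univ _, hφe⟩, fun r => mem_image_of_mem _ (mem_univ r), ?_, ?_, hφe,
    ?_, ?_⟩
  · intro u hu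
    obtain ⟨i, rfl⟩ := Option.ne_none_iff_exists'.mp hu
    exact hgd
  · intro S hS
    obtain ⟨r, -, rfl⟩ := mem_image.mp hS
    obtain ⟨u, hu⟩ := hF r
    exact ⟨u, (hmem r u).mpr hu⟩
  · intro u
    refine ⟨φ (F u), ⟨mem_image_of_mem _ (mem_univ _), (hmem _ _).mpr rfl⟩, ?_⟩
    rintro S ⟨hS, hu⟩
    obtain ⟨r, -, rfl⟩ := mem_image.mp hS
    rw [(hmem r u).mp hu]
  · intro r t hrt
    obtain ⟨u, hu⟩ := hF r
    have h : u ∈ φ t := hrt ▸ (hmem r u).mpr hu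
    rw [← hu, (hmem t u).mp h]
  · intro S hS
    obtain ⟨r, -, rfl⟩ := mem_image.mp hS
    exact ⟨r, rfl⟩
  · intro r hr
    rw [hφ r hr, card_map, hcard r hr]
  · intro p q t w hw
    obtain rfl := (hmem t w).mp hw
    by_cases hp : p = A.e
    · rw [hp, hA.2.2.2.1, hφe, sum_singleton]
      simp only [homogeneousAmorphic_c_none_left, sum_ite_eq', hmem,
        eq_comm (b := F w)]
    by_cases hq : q = A.e
    · rw [hq, hA.2.2.2.2.1, hφe]
      simp only [sum_singleton, homogeneousAmorphic_c_none_right, sum_ite_eq', hmem,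
        eq_comm (b := F w)]
    simp only [hφ p hp, hφ q hq, sum_map, Function.Embedding.some_apply]
    cases w with
    | none =>
      simp only [homogeneousAmorphic_c_some_some_none, hgd, sum_ite_eq, mem_filter, mem_univ,
        true_and]
      change A.c p q A.e = _
      rw [hA.2.2.2.2.2.2.2.1, ham.inv_eq_self hA hnt, Finset.sum_congr rfl
        (g := fun _ => if p = q then (1 / N : ℝ) else 0)
        fun i hi => by rw [(mem_filter.mp hi).2], sum_const, nsmul_eq_mul, hcard p hp]
      rcases eq_or_ne p q with rfl | hpq
      · simp only [if_true]
        field_simp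
      · simp [hpq, hpq.symm]
    | some x =>
      simp only [homogeneousAmorphic_c_some_some_some]
      change A.c p q (f x) = _
      rw [ham.c_eq_amorphicCoeff hA hnt hε hp hq (hfe x), sum_sum_amorphicCoeff]
      have hw : ∀ r, r ≠ A.e →
          ((univ.filter fun i => f i = r).card : ℝ) * g = A.d r / (s + ε) := by
        intro r hr
        rw [hcard r hr, hgdef]
        field_simp
      simp only [amorphicCoeff, hw p hp, hw q hq, hs]
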